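/- Let r ≥ 2 be an integer and ε > 0. There exists a constant C = C(r, ε) > 0 such that for every b ∈ ℝ^r, every real N > 1, and every family of complex coefficients (a_ξ)_{ξ ∈ ℤ^r}, one has (∫_0^{2π} |∑_{ξ ∈ J_{b,N}} a_ξ e^{−i t |ξ|²}|² dt)^{1/2} ≤ C · N^{r/2 − 1 + ε} · (∑_{ξ ∈ J_{b,N}} |a_ξ|²)^{1/2}, with C independent of b and N. -/

import Mathlib

open MeasureTheory Real

noncomputable section

/-- The lattice box `J_{b,N} = {ξ ∈ ℤ^r : b i ≤ ξ i ≤ b i + N for all i}`. -/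
def latticeBox (r : ℕ) (b : Fin r → ℝ) (N : ℝ) : Finset (Fin r → ℤ) :=
  Fintype.piFinset fun i => Finset.Icc ⌈b i⌉ ⌊b i + N⌋

/-- The squared Euclidean norm `|ξ|²` of a lattice point. -/
def eNormSq {r : ℕ} (ξ : Fin r → ℤ) : ℝ := ∑ i, ((ξ i : ℝ)) ^ 2

/-- The divisor bound `d(n) ≪ n ^ δ`. -/
theorem exists_card_divisors_le_rpow (δ : ℝ) (hδ : 0 < δ) :
    ∃ C : ℝ, 0 < C ∧ ∀ n : ℕ, n ≠ 0 → ((n.divisors.card : ℕ) : ℝ) ≤ C * (n : ℝ) ^ δ := by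
  set A : ℝ := max 1 (1 / (δ * Real.log 2)) with hA
  set P : ℕ := ⌈(2 : ℝ) ^ (1 / δ)⌉₊ with hP
  have hA1 : 1 ≤ A := le_max_left _ _
  have hlog : 0 < δ * Real.log 2 := mul_pos hδ (Real.log_pos one_lt_two)
  have hAlog : 1 ≤ A * (δ * Real.log 2) := by
    rw [← div_le_iff₀ hlog]
    exact le_max_right _ _
  refine ⟨A ^ P, by positivity, fun n hn => ?_⟩
  have key : ∀ p ∈ n.primeFactors, ((n.factorization p + 1 : ℕ) : ℝ) ≤
      (if p < P then A else 1) * ((p : ℝ) ^ n.factorization p) ^ δ := by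
    intro p hp
    have hp2 : (2 : ℝ) ≤ p := by exact_mod_cast (Nat.prime_of_mem_primeFactors hp).two_le
    generalize n.factorization p = v
    rw [← Real.rpow_natCast, ← Real.rpow_mul (by positivity)]
    split_ifs with h
    · have h1 : 1 + v * (δ * Real.log 2) ≤ (p : ℝ) ^ ((v : ℝ) * δ) := by
        calc 1 + v * (δ * Real.log 2) ≤ Real.exp (v * (δ * Real.log 2)) := by
              rw [add_comm]; exact Real.add_one_le_exp _
          _ = (2 : ℝ) ^ ((v : ℝ) * δ) := by
              rw [Real.rpow_def_of_pos two_pos]; ring_nf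
          _ ≤ _ := by gcongr
      calc ((v + 1 : ℕ) : ℝ) = v * 1 + 1 := by push_cast; ring
        _ ≤ v * (A * (δ * Real.log 2)) + A := by gcongr
        _ = A * (1 + v * (δ * Real.log 2)) := by ring
        _ ≤ _ := by gcongr
    · have hPp : (2 : ℝ) ^ (1 / δ) ≤ p :=
        (Nat.le_ceil _).trans (by exact_mod_cast not_lt.mp h)
      have h2 : (2 : ℝ) ≤ (p : ℝ) ^ δ := by
        calc (2 : ℝ) = ((2 : ℝ) ^ (1 / δ)) ^ δ := by
              rw [← Real.rpow_mul two_pos.le, one_div_mul_cancel hδ.ne', Real.rpow_one]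
          _ ≤ _ := by gcongr
      rw [one_mul, mul_comm, Real.rpow_mul (by positivity), Real.rpow_natCast]
      calc ((v + 1 : ℕ) : ℝ) ≤ (2 : ℝ) ^ v := by exact_mod_cast Nat.lt_two_pow_self
        _ ≤ _ := by gcongr
  have hcard : ∏ p ∈ n.primeFactors, (if p < P then A else 1) ≤ A ^ P := by
    rw [← Finset.prod_filter, Finset.prod_const]
    refine pow_le_pow_right₀ hA1 ?_
    calc _ ≤ (Finset.range P).card := Finset.card_le_card fun p hp => by
          simpa using (Finset.mem_filter.mp hp).2
      _ = P := Finset.card_range P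
  have hprod : ∏ p ∈ n.primeFactors, ((p : ℝ) ^ n.factorization p) ^ δ = (n : ℝ) ^ δ := by
    rw [Real.finsetProd_rpow _ _ fun p _ => by positivity]
    congr 1
    exact_mod_cast Nat.prod_factorization_pow_eq_self hn
  rw [Nat.card_divisors hn, Nat.cast_prod]
  calc _ ≤ ∏ p ∈ n.primeFactors, (if p < P then A else 1) * ((p : ℝ) ^ n.factorization p) ^ δ :=
        Finset.prod_le_prod (fun _ _ => by positivity) key
    _ ≤ A ^ P * (n : ℝ) ^ δ := by
        rw [Finset.prod_mul_distrib, hprod]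
        gcongr

/-- If `ρ` is a Gaussian prime over the rational prime `p`, then the `p`-part of a Gaussian integer
of norm `p ^ k * m`, with `m` prime to `p`, is `ρ ^ a * star ρ ^ b` with `a, b ≤ k`. -/
theorem GaussianInt.exists_eq_pow_mul_star_pow_mul {p m : ℕ} (hp : p.Prime) (hpm : ¬ p ∣ m)
    {ρ : GaussianInt} (hρ : Prime ρ) (hdvd : ρ ∣ (p : GaussianInt)) :
    ∀ (k : ℕ) (z : GaussianInt), z.norm = (p ^ k * m : ℕ) →
      ∃ a ≤ k, ∃ b ≤ k, ∃ w : GaussianInt, w.norm = m ∧ z = ρ ^ a * star ρ ^ b * w := by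
  obtain ⟨j, hj2, hj⟩ : ∃ j ≤ 2, ρ.norm.natAbs = p ^ j := by
    rw [← Nat.dvd_prime_pow hp]
    obtain ⟨c, hc⟩ := hdvd
    have := congrArg Zsqrtd.norm hc
    rw [Zsqrtd.norm_natCast, Zsqrtd.norm_mul] at this
    have := congrArg Int.natAbs this
    rw [Int.natAbs_mul, Int.natAbs_mul, Int.natAbs_natCast] at this
    exact ⟨_, by rw [sq, this]⟩
  have hj0 : 1 ≤ j := by
    by_contra! h
    obtain rfl : j = 0 := by omega
    exact hρ.not_isUnit (Zsqrtd.norm_eq_one_iff.mp (by simpa using hj))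
  have hnorm : ρ.norm = (p ^ j : ℕ) := by
    rw [← hj, GaussianInt.abs_natCast_norm]
  have step : ∀ (k : ℕ) (τ z' : GaussianInt), τ.norm = (p ^ j : ℕ) →
      (τ * z').norm = (p ^ k * m : ℕ) → ∃ l, l + j = k ∧ z'.norm = (p ^ l * m : ℕ) := by
    intro k τ z' hτ hz
    rw [Zsqrtd.norm_mul, hτ, ← GaussianInt.abs_natCast_norm z'] at hz
    have hz : p ^ j * z'.norm.natAbs = p ^ k * m := by exact_mod_cast hz
    have hjk : j ≤ k := by
      by_contra! h
      apply hpm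
      have h1 : p ^ (k + 1) ∣ p ^ k * m := (pow_dvd_pow p h).trans ⟨_, hz.symm⟩
      rw [pow_succ] at h1
      exact Nat.dvd_of_mul_dvd_mul_left (pow_pos hp.pos k) h1
    obtain ⟨l, rfl⟩ := Nat.exists_eq_add_of_le hjk
    refine ⟨l, by omega, ?_⟩
    rw [pow_add, mul_assoc] at hz
    rw [← GaussianInt.abs_natCast_norm z', Nat.eq_of_mul_eq_mul_left (pow_pos hp.pos j) hz]
  intro k
  induction k using Nat.strong_induction_on with
  | _ k ih =>
    intro z hz
    rcases Nat.eq_zero_or_pos k with rfl | hk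
    · exact ⟨0, le_rfl, 0, le_rfl, z, by simpa using hz, by simp⟩
    have hzz : ρ ∣ z * star z := by
      rw [← Zsqrtd.norm_eq_mul_conj, hz]
      push_cast
      exact (hdvd.trans (dvd_pow_self _ hk.ne')).mul_right _
    rcases hρ.dvd_or_dvd hzz with h | h
    · obtain ⟨z', rfl⟩ := h
      obtain ⟨l, hl, hz'⟩ := step k ρ z' hnorm hz
      obtain ⟨a, ha, b, hb, w, hw, rfl⟩ := ih l (by omega) z' hz'
      exact ⟨a + 1, by omega, b, by omega, w, hw, by ring⟩
    · obtain ⟨y, hy⟩ := h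
      obtain rfl : z = star ρ * star y := by
        rw [← star_star z, hy, star_mul, mul_comm]
      obtain ⟨l, hl, hz'⟩ := step k (star ρ) (star y) (by rw [Zsqrtd.norm_conj, hnorm]) hz
      obtain ⟨a, ha, b, hb, w, hw, hyw⟩ := ih l (by omega) (star y) hz'
      exact ⟨a, by omega, b + 1, by omega, w, hw, by rw [hyw]; ring⟩

/-- The number of Gaussian integers of norm `n` is `O(d(n) ^ 2)`. -/
theorem GaussianInt.exists_finset_norm_eq (n : ℕ) (hn : n ≠ 0) :
    ∃ S : Finset GaussianInt, (∀ z : GaussianInt, z.norm = n → z ∈ S) ∧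
      S.card ≤ 9 * n.divisors.card ^ 2 := by
  classical
  induction n using Nat.recOnPrimePow with
  | zero => exact absurd rfl hn
  | one =>
    refine ⟨(Finset.Icc (-1 : ℤ) 1 ×ˢ Finset.Icc (-1 : ℤ) 1).image fun q => ⟨q.1, q.2⟩,
      fun z hz => ?_, Finset.card_image_le.trans (by simp)⟩
    rw [Zsqrtd.norm_def] at hz
    refine Finset.mem_image.mpr ⟨(z.re, z.im), ?_, rfl⟩
    simp only [Finset.mem_product, Finset.mem_Icc]
    push_cast at hz
    refine ⟨⟨?_, ?_⟩, ?_, ?_⟩ <;> nlinarith [sq_nonneg z.re, sq_nonneg z.im]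
  | prime_pow_mul m p k hp hpm hk ih =>
    have hm : m ≠ 0 := by rintro rfl; exact hn (mul_zero _)
    obtain ⟨S, hS, hcard⟩ := ih hm
    obtain ⟨ρ, hρirr, hρ⟩ := WfDvdMonoid.exists_irreducible_factor
      (a := (p : GaussianInt))
      (fun h => by
        have := Zsqrtd.norm_eq_one_iff.mpr h
        rw [Zsqrtd.norm_natCast, Int.natAbs_mul, Int.natAbs_natCast] at this
        exact hp.one_lt.ne' (Nat.eq_one_of_mul_eq_one_left this))
      (by exact_mod_cast hp.ne_zero)
    refine ⟨(Finset.range (k + 1) ×ˢ Finset.range (k + 1) ×ˢ S).image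
      fun q => ρ ^ q.1 * star ρ ^ q.2.1 * q.2.2, fun z hz => ?_, ?_⟩
    · obtain ⟨a, ha, b, hb, w, hw, rfl⟩ :=
        exists_eq_pow_mul_star_pow_mul hp hpm hρirr.prime hρ k z hz
      refine Finset.mem_image.mpr ⟨(a, b, w), ?_, rfl⟩
      simp [Nat.lt_succ_of_le ha, Nat.lt_succ_of_le hb, hS w hw]
    · refine Finset.card_image_le.trans ?_
      have hcop : (p ^ k).Coprime m := ((Nat.Prime.coprime_iff_not_dvd hp).mpr hpm).pow_left k
      rw [hcop.card_divisors_mul, Nat.divisors_prime_pow hp]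
      simp only [Finset.card_product, Finset.card_range, Finset.card_map]
      calc _ ≤ (k + 1) * ((k + 1) * (9 * m.divisors.card ^ 2)) := by gcongr
        _ = _ := by ring

/-- Three distinct lattice points on the circle `x ^ 2 + y ^ 2 = k` that lie within `N` of each other
in both coordinates force `k ≤ 2 * N ^ 6`. -/
theorem le_two_mul_pow_six_of_three_points {k : ℤ} {N : ℝ} {x y z : ℤ × ℤ}
    (hx : x.1 ^ 2 + x.2 ^ 2 = k) (hy : y.1 ^ 2 + y.2 ^ 2 = k) (hz : z.1 ^ 2 + z.2 ^ 2 = k)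
    (hxy : x ≠ y) (hxz : x ≠ z) (hyz : y ≠ z)
    (hxy1 : |((x.1 - y.1 : ℤ) : ℝ)| ≤ N) (hxy2 : |((x.2 - y.2 : ℤ) : ℝ)| ≤ N)
    (hxz1 : |((x.1 - z.1 : ℤ) : ℝ)| ≤ N) (hxz2 : |((x.2 - z.2 : ℤ) : ℝ)| ≤ N)
    (hyz1 : |((y.1 - z.1 : ℤ) : ℝ)| ≤ N) (hyz2 : |((y.2 - z.2 : ℤ) : ℝ)| ≤ N) :
    (k : ℝ) ≤ 2 * N ^ 6 := by
  have hpos : ∀ u v : ℤ × ℤ, u ≠ v → 0 < (u.1 - v.1) ^ 2 + (u.2 - v.2) ^ 2 := by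
    intro u v huv
    by_cases h : u.1 = v.1
    · have : u.2 - v.2 ≠ 0 := fun h2 => huv (Prod.ext h (sub_eq_zero.mp h2))
      positivity
    · have : u.1 - v.1 ≠ 0 := sub_ne_zero.mpr h
      positivity
  have hbound : ∀ s t : ℤ, |(s : ℝ)| ≤ N → |(t : ℝ)| ≤ N → ((s ^ 2 + t ^ 2 : ℤ) : ℝ) ≤ 2 * N ^ 2 := by
    intro s t hs ht
    push_cast
    linarith [sq_le_sq' (abs_le.mp hs).1 (abs_le.mp hs).2,
      sq_le_sq' (abs_le.mp ht).1 (abs_le.mp ht).2]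
  set A := (x.1 - y.1) ^ 2 + (x.2 - y.2) ^ 2 with hA
  set B := (x.1 - z.1) ^ 2 + (x.2 - z.2) ^ 2 with hB
  set E := (y.1 - z.1) ^ 2 + (y.2 - z.2) ^ 2 with hE
  set D := (y.1 - x.1) * (z.2 - x.2) - (y.2 - x.2) * (z.1 - x.1) with hD
  have hA0 := hpos x y hxy
  have hB0 := hpos x z hxz
  have hE0 := hpos y z hyz
  have hident : 4 * k * D ^ 2 = A * B * E := by
    have h1 : A * (z.1 - x.1) - B * (y.1 - x.1) = 2 * x.2 * D := by
      rw [hA, hB, hD]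
      linear_combination (z.1 - x.1) * (hy - hx) - (y.1 - x.1) * (hz - hx)
    have h2 : A * (z.2 - x.2) - B * (y.2 - x.2) = -2 * x.1 * D := by
      rw [hA, hB, hD]
      linear_combination (z.2 - x.2) * (hy - hx) - (y.2 - x.2) * (hz - hx)
    calc 4 * k * D ^ 2 = (2 * x.2 * D) ^ 2 + (-2 * x.1 * D) ^ 2 := by rw [← hx]; ring
      _ = A * B * E := by
        rw [← h1, ← h2, hA, hB, hE]
        ring
  have hk0 : 0 ≤ k := by rw [← hx]; positivity
  have hD0 : D ≠ 0 := by
    intro h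
    rw [h] at hident
    have : 0 < A * B * E := mul_pos (mul_pos hA0 hB0) hE0
    linarith
  have hD1 : 1 ≤ D ^ 2 := by
    have := sq_pos_of_ne_zero hD0
    omega
  have h4 : 4 * k ≤ A * B * E := by
    rw [← hident]
    exact le_mul_of_one_le_right (by positivity) hD1
  have h4' : 4 * (k : ℝ) ≤ (A : ℝ) * B * E := by exact_mod_cast h4
  have hA' := hbound _ _ hxy1 hxy2
  have hB' := hbound _ _ hxz1 hxz2
  have hE' := hbound _ _ hyz1 hyz2
  have hAr : (0 : ℝ) ≤ A := by exact_mod_cast hA0.le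
  have hBr : (0 : ℝ) ≤ B := by exact_mod_cast hB0.le
  have hEr : (0 : ℝ) ≤ E := by exact_mod_cast hE0.le
  have : (A : ℝ) * B * E ≤ (2 * N ^ 2) * (2 * N ^ 2) * (2 * N ^ 2) := by gcongr
  linarith

theorem abs_sub_le_of_mem_Icc_ceil_floor {c N : ℝ} {m n : ℤ} (hm : m ∈ Finset.Icc ⌈c⌉ ⌊c + N⌋)
    (hn : n ∈ Finset.Icc ⌈c⌉ ⌊c + N⌋) : |((m - n : ℤ) : ℝ)| ≤ N := by
  simp only [Finset.mem_Icc, Int.ceil_le, Int.le_floor] at hm hn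
  rw [abs_le]
  push_cast
  constructor <;> linarith [hm.1, hm.2, hn.1, hn.2]

theorem card_Icc_ceil_floor_le (c : ℝ) {N : ℝ} (hN : 1 ≤ N) :
    ((Finset.Icc ⌈c⌉ ⌊c + N⌋).card : ℝ) ≤ 2 * N := by
  rw [Int.card_Icc]
  have h1 := Int.floor_le (c + N)
  have h2 := Int.le_ceil c
  have h3 : (((⌊c + N⌋ + 1 - ⌈c⌉).toNat : ℤ) : ℝ) ≤ 2 * N := by
    rw [Int.toNat_eq_max, Int.cast_max]
    push_cast
    exact max_le (by linarith) (by linarith)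
  exact_mod_cast h3

/-- A circle centred at the origin has `O(N ^ ε)` lattice points in any square of side `N`, uniformly
in the radius and in the position of the square. -/
theorem exists_card_circle_inter_square_le (ε : ℝ) (hε : 0 < ε) :
    ∃ C : ℝ, 0 < C ∧ ∀ (c d N : ℝ) (k : ℤ), 1 < N →
      ((((Finset.Icc ⌈c⌉ ⌊c + N⌋ ×ˢ Finset.Icc ⌈d⌉ ⌊d + N⌋).filter
        fun x : ℤ × ℤ => x.1 ^ 2 + x.2 ^ 2 = k).card : ℕ) : ℝ) ≤ C * N ^ ε := by
  obtain ⟨C, hC, hdiv⟩ := exists_card_divisors_le_rpow (ε / 12) (by positivity)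
  refine ⟨2 + 9 * (C ^ 2 * 2 ^ (ε / 6)), by positivity, fun c d N k hN => ?_⟩
  have hN0 : 0 < N := by linarith
  have hNε : 1 ≤ N ^ ε := Real.one_le_rpow hN.le hε.le
  set T := (Finset.Icc ⌈c⌉ ⌊c + N⌋ ×ˢ Finset.Icc ⌈d⌉ ⌊d + N⌋).filter
    fun x : ℤ × ℤ => x.1 ^ 2 + x.2 ^ 2 = k with hT
  suffices h : (T.card : ℝ) ≤ 2 ∨ (T.card : ℝ) ≤ 9 * (C ^ 2 * 2 ^ (ε / 6)) * N ^ ε by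
    have h9 : 0 ≤ 9 * (C ^ 2 * 2 ^ (ε / 6)) * N ^ ε := by positivity
    rw [add_mul]
    rcases h with h | h <;> linarith
  by_cases hT2 : T.card ≤ 2
  · left; exact_mod_cast hT2
  right
  obtain ⟨x, hx, y, hy, z, hz, hxy, hxz, hyz⟩ := Finset.two_lt_card.mp (not_le.mp hT2)
  simp only [hT, Finset.mem_filter, Finset.mem_product] at hx hy hz
  have hk : (k : ℝ) ≤ 2 * N ^ 6 := le_two_mul_pow_six_of_three_points hx.2 hy.2 hz.2 hxy hxz hyz
    (abs_sub_le_of_mem_Icc_ceil_floor hx.1.1 hy.1.1) (abs_sub_le_of_mem_Icc_ceil_floor hx.1.2 hy.1.2)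
    (abs_sub_le_of_mem_Icc_ceil_floor hx.1.1 hz.1.1) (abs_sub_le_of_mem_Icc_ceil_floor hx.1.2 hz.1.2)
    (abs_sub_le_of_mem_Icc_ceil_floor hy.1.1 hz.1.1) (abs_sub_le_of_mem_Icc_ceil_floor hy.1.2 hz.1.2)
  have hk0 : 0 ≤ k := by rw [← hx.2]; positivity
  have hkne : k ≠ 0 := by
    rintro rfl
    apply hxy
    ext <;> apply pow_eq_zero_iff two_ne_zero |>.mp _ |>.trans (pow_eq_zero_iff two_ne_zero |>.mp _).symm
    all_goals nlinarith [sq_nonneg x.1, sq_nonneg x.2, sq_nonneg y.1, sq_nonneg y.2]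
  lift k to ℕ using hk0
  have hkne : k ≠ 0 := by exact_mod_cast hkne
  obtain ⟨S, hS, hcard⟩ := GaussianInt.exists_finset_norm_eq k hkne
  have hTS : T.card ≤ S.card := by
    refine Finset.card_le_card_of_injOn (fun q => (⟨q.1, q.2⟩ : GaussianInt)) (fun q hq => ?_) ?_
    · refine hS _ ?_
      rw [Zsqrtd.norm_def, ← (Finset.mem_filter.mp hq).2]
      ring
    · intro q _ q' _ h
      exact Prod.ext (congrArg Zsqrtd.re h) (congrArg Zsqrtd.im h)
  have hk' : (k : ℝ) ≤ 2 * N ^ 6 := by exact_mod_cast hk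
  have hpow : ((2 * N ^ 6) ^ (ε / 12)) ^ 2 = 2 ^ (ε / 6) * N ^ ε := by
    rw [← Real.rpow_natCast (_ ^ (ε / 12)), ← Real.rpow_mul (by positivity),
      Real.mul_rpow (by positivity) (by positivity), ← Real.rpow_natCast N,
      ← Real.rpow_mul hN0.le]
    congr 2 <;> push_cast <;> ring
  calc (T.card : ℝ) ≤ ((9 * k.divisors.card ^ 2 : ℕ) : ℝ) := by exact_mod_cast hTS.trans hcard
    _ = 9 * (k.divisors.card : ℝ) ^ 2 := by push_cast; ring
    _ ≤ 9 * (C * (2 * N ^ 6) ^ (ε / 12)) ^ 2 := by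
        gcongr
        exact (hdiv k hkne).trans (by gcongr)
    _ = _ := by rw [mul_pow, hpow]; ring

/-- A sphere in dimension `s + 2` has `O(N ^ (s + ε))` lattice points in any cube of side `N`,
uniformly in the radius and in the position of the cube. -/
theorem exists_card_sphere_inter_latticeBox_le (s : ℕ) (ε : ℝ) (hε : 0 < ε) :
    ∃ C : ℝ, 0 < C ∧ ∀ (b : Fin (s + 2) → ℝ) (N : ℝ) (k : ℤ), 1 < N →
      ((((latticeBox (s + 2) b N).filter fun ξ => ∑ i, ξ i ^ 2 = k).card : ℕ) : ℝ) ≤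
        C * N ^ ((s : ℝ) + ε) := by
  obtain ⟨C, hC, hcirc⟩ := exists_card_circle_inter_square_le ε hε
  refine ⟨C * 2 ^ s, by positivity, fun b N k hN => ?_⟩
  have hN0 : 0 < N := by linarith
  set I : Fin (s + 2) → Finset ℤ := fun i => Finset.Icc ⌈b i⌉ ⌊b i + N⌋ with hI
  have hmem : ∀ ξ, ξ ∈ latticeBox (s + 2) b N ↔ ∀ i, ξ i ∈ I i := fun ξ => Fintype.mem_piFinset
  set U := Fintype.piFinset fun i : Fin s => I i.succ.succ with hU
  have hfib : ∀ η ∈ U, (((latticeBox (s + 2) b N).filter fun ξ => ∑ i, ξ i ^ 2 = k).filter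
      fun ξ => (fun i : Fin s => ξ i.succ.succ) = η).card ≤ ⌊C * N ^ ε⌋₊ := by
    intro η _
    refine Nat.le_floor (le_trans ?_ (hcirc (b 0) (b 1) N (k - ∑ i, η i ^ 2) hN))
    norm_cast
    refine Finset.card_le_card_of_injOn (fun ξ => (ξ 0, ξ 1)) (fun ξ hξ => ?_) ?_
    · simp only [Finset.coe_filter, Set.mem_ofPred_eq, Finset.mem_filter, hmem] at hξ
      obtain ⟨⟨hbox, hsum⟩, rfl⟩ := hξ
      rw [Fin.sum_univ_succ, Fin.sum_univ_succ] at hsum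
      simp only [Finset.coe_filter, Set.mem_ofPred_eq, Finset.mem_product]
      refine ⟨⟨hbox 0, hbox 1⟩, ?_⟩
      rw [← hsum, Fin.succ_zero_eq_one]
      ring
    · intro ξ hξ ξ' hξ' h
      have h1 := (Finset.mem_filter.mp hξ).2
      have h2 := (Finset.mem_filter.mp hξ').2
      rw [Prod.mk.injEq] at h
      funext i
      refine Fin.cases h.1 (fun j => Fin.cases h.2 (fun l => ?_) j) i
      exact congrFun (h1.trans h2.symm) l
  have hle := Finset.card_le_mul_card_image_of_maps_to (t := U)
    (f := fun ξ : Fin (s + 2) → ℤ => fun i : Fin s => ξ i.succ.succ)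
    (s := (latticeBox (s + 2) b N).filter fun ξ => ∑ i, ξ i ^ 2 = k)
    (fun ξ hξ => Fintype.mem_piFinset.mpr fun i =>
      (hmem ξ).mp (Finset.mem_filter.mp hξ).1 i.succ.succ) _ hfib
  have hUcard : (U.card : ℝ) ≤ (2 * N) ^ s := by
    rw [hU, Fintype.card_piFinset, Nat.cast_prod]
    calc _ ≤ ∏ _i : Fin s, (2 * N) := Finset.prod_le_prod (fun _ _ => by positivity)
          fun i _ => card_Icc_ceil_floor_le _ hN.le
      _ = _ := by simp
  calc _ ≤ ((⌊C * N ^ ε⌋₊ * U.card : ℕ) : ℝ) := by exact_mod_cast hle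
    _ = (⌊C * N ^ ε⌋₊ : ℝ) * U.card := by push_cast; ring
    _ ≤ (C * N ^ ε) * (2 * N) ^ s := by
        gcongr
        exact Nat.floor_le (by positivity)
    _ = _ := by
        rw [Real.rpow_add hN0, Real.rpow_natCast, mul_pow]
        ring

theorem integral_exp_neg_I_mul_int (m : ℤ) :
    ∫ t in (0 : ℝ)..(2 * π), Complex.exp (-(Complex.I * (t : ℂ) * (m : ℂ))) =
      if m = 0 then ((2 * π : ℝ) : ℂ) else 0 := by
  split_ifs with h
  · simp [h]
  · have hc : -(Complex.I * (m : ℂ)) ≠ 0 := by simp [h]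
    have : ∀ t : ℝ, -(Complex.I * (t : ℂ) * (m : ℂ)) = -(Complex.I * (m : ℂ)) * t := fun t => by ring
    simp only [this]
    rw [integral_exp_mul_complex hc]
    have h1 : Complex.exp (-(Complex.I * (m : ℂ)) * ((2 * π : ℝ) : ℂ)) = 1 := by
      rw [Complex.exp_eq_one_iff]
      exact ⟨-m, by push_cast; ring⟩
    rw [h1]
    simp

/-- The `L²` norm over a period of a trigonometric polynomial whose frequencies have multiplicity at
most `M`. -/
theorem integral_norm_sq_sum_exp_le {ι : Type*} (S : Finset ι) (q : ι → ℤ) (a : ι → ℂ) (M : ℝ)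
    (hM : ∀ k, ((S.filter fun y => q y = k).card : ℝ) ≤ M) :
    ∫ t in (0 : ℝ)..(2 * π),
        ‖∑ x ∈ S, a x * Complex.exp (-(Complex.I * (t : ℂ) * (q x : ℂ)))‖ ^ 2 ≤
      2 * π * M * ∑ x ∈ S, ‖a x‖ ^ 2 := by
  have hexpand : ∀ t : ℝ,
      ((‖∑ x ∈ S, a x * Complex.exp (-(Complex.I * (t : ℂ) * (q x : ℂ)))‖ ^ 2 : ℝ) : ℂ) =
      ∑ x ∈ S, ∑ y ∈ S, a x * starRingEnd ℂ (a y) *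
        Complex.exp (-(Complex.I * (t : ℂ) * ((q x - q y : ℤ) : ℂ))) := by
    intro t
    rw [Complex.ofReal_pow, ← Complex.mul_conj', map_sum, Finset.sum_mul_sum]
    refine Finset.sum_congr rfl fun x _ => Finset.sum_congr rfl fun y _ => ?_
    rw [map_mul, ← Complex.exp_conj, mul_mul_mul_comm, ← Complex.exp_add]
    congr 2
    simp
    ring
  have hcast : ((∫ t in (0 : ℝ)..(2 * π),
      ‖∑ x ∈ S, a x * Complex.exp (-(Complex.I * (t : ℂ) * (q x : ℂ)))‖ ^ 2 : ℝ) : ℂ) =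
      ∑ x ∈ S, ∑ y ∈ S, a x * starRingEnd ℂ (a y) *
        (if q y = q x then ((2 * π : ℝ) : ℂ) else 0) := by
    rw [← intervalIntegral.integral_ofReal]
    simp only [hexpand]
    rw [intervalIntegral.integral_finsetSum fun x _ =>
      Continuous.intervalIntegrable (by fun_prop) _ _]
    refine Finset.sum_congr rfl fun x _ => ?_
    rw [intervalIntegral.integral_finsetSum fun y _ =>
      Continuous.intervalIntegrable (by fun_prop) _ _]
    refine Finset.sum_congr rfl fun y _ => ?_
    rw [intervalIntegral.integral_const_mul, integral_exp_neg_I_mul_int]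
    simp only [sub_eq_zero, eq_comm]
  have hterm : ∀ x y, (a x * starRingEnd ℂ (a y) *
      (if q y = q x then ((2 * π : ℝ) : ℂ) else 0)).re ≤
      π * (if q y = q x then ‖a x‖ ^ 2 else 0) + π * (if q x = q y then ‖a y‖ ^ 2 else 0) := by
    intro x y
    by_cases h : q y = q x
    · rw [if_pos h, if_pos h, if_pos h.symm, Complex.re_mul_ofReal]
      have h1 : (a x * starRingEnd ℂ (a y)).re ≤ ‖a x‖ * ‖a y‖ := by
        refine (Complex.re_le_norm _).trans_eq ?_
        rw [norm_mul, RCLike.norm_conj]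
      have h2 := two_mul_le_add_sq ‖a x‖ ‖a y‖
      nlinarith [pi_pos]
    · rw [if_neg h, if_neg h, if_neg (Ne.symm h)]
      simp
  have hsum : ∑ x ∈ S, ∑ y ∈ S, (if q y = q x then ‖a x‖ ^ 2 else 0) ≤
      M * ∑ x ∈ S, ‖a x‖ ^ 2 := by
    rw [Finset.mul_sum]
    refine Finset.sum_le_sum fun x _ => ?_
    rw [← Finset.sum_filter, Finset.sum_const, nsmul_eq_mul]
    gcongr
    exact hM _
  have hre := congrArg Complex.re hcast
  rw [Complex.ofReal_re, Complex.re_sum] at hre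
  rw [hre]
  calc _ ≤ ∑ x ∈ S, ∑ y ∈ S, (π * (if q y = q x then ‖a x‖ ^ 2 else 0) +
        π * (if q x = q y then ‖a y‖ ^ 2 else 0)) := by
        refine Finset.sum_le_sum fun x _ => ?_
        rw [Complex.re_sum]
        exact Finset.sum_le_sum fun y _ => hterm x y
    _ = π * ∑ x ∈ S, ∑ y ∈ S, (if q y = q x then ‖a x‖ ^ 2 else 0) +
        π * ∑ y ∈ S, ∑ x ∈ S, (if q x = q y then ‖a y‖ ^ 2 else 0) := by
        simp only [Finset.sum_add_distrib, Finset.mul_sum]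
        congr 1
        exact Finset.sum_comm
    _ ≤ π * (M * ∑ x ∈ S, ‖a x‖ ^ 2) + π * (M * ∑ x ∈ S, ‖a x‖ ^ 2) := by gcongr
    _ = _ := by ring

theorem exponential_sum_L2_estimate
    (r : ℕ) (hr : 2 ≤ r) (ε : ℝ) (hε : 0 < ε) :
    ∃ C : ℝ, 0 < C ∧ ∀ (b : Fin r → ℝ) (N : ℝ), 1 < N →
      ∀ a : (Fin r → ℤ) → ℂ,
        (∫ t in (0:ℝ)..(2 * π),
            ‖∑ ξ ∈ latticeBox r b N,
                a ξ * Complex.exp (-(Complex.I * (t : ℂ) * (eNormSq ξ : ℂ)))‖ ^ 2) ^ ((1 : ℝ) / 2)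
          ≤ C * N ^ ((r : ℝ) / 2 - 1 + ε) *
            (∑ ξ ∈ latticeBox r b N, ‖a ξ‖ ^ 2) ^ ((1 : ℝ) / 2) := by
  obtain ⟨s, rfl⟩ := Nat.exists_eq_add_of_le' hr
  obtain ⟨C, hC, hcount⟩ := exists_card_sphere_inter_latticeBox_le s (2 * ε) (by positivity)
  refine ⟨(2 * π * C) ^ ((1 : ℝ) / 2), by positivity, fun b N hN a => ?_⟩
  have hN0 : 0 < N := by linarith
  have hnorm : ∀ ξ : Fin (s + 2) → ℤ, (eNormSq ξ : ℂ) = ((∑ i, ξ i ^ 2 : ℤ) : ℂ) := by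
    intro ξ
    simp [eNormSq]
  simp only [hnorm]
  have hint := integral_norm_sq_sum_exp_le (latticeBox (s + 2) b N) (fun ξ => ∑ i, ξ i ^ 2) a
    (C * N ^ ((s : ℝ) + 2 * ε)) fun k => hcount b N k hN
  have hS : 0 ≤ ∑ ξ ∈ latticeBox (s + 2) b N, ‖a ξ‖ ^ 2 := by positivity
  have hint0 : 0 ≤ ∫ t in (0 : ℝ)..(2 * π), ‖∑ ξ ∈ latticeBox (s + 2) b N,
      a ξ * Complex.exp (-(Complex.I * (t : ℂ) * ((∑ i, ξ i ^ 2 : ℤ) : ℂ)))‖ ^ 2 :=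
    intervalIntegral.integral_nonneg (by positivity) fun _ _ => by positivity
  refine (Real.rpow_le_rpow hint0 hint (by norm_num)).trans_eq ?_
  rw [Real.mul_rpow (by positivity) hS, ← mul_assoc, Real.mul_rpow (by positivity) (by positivity),
    ← Real.rpow_mul hN0.le]
  congr 3
  push_cast
  ring
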